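/- Let G be a finite group having an abelian normal subgroup V which is a minimal normal subgroup of G (V ≠ 1 and no nontrivial proper subgroup of V is normal in G), and suppose V has a complement H in G with C_H(V) = 1. If H is solvable and non-cyclic, then G does not satisfy the MGSE property. -/

import Mathlib

/-- A subset `S` of a group is a minimal generating set if it generates the whole
group but no proper subset obtained by removing one element does. -/
def IsMinimalGeneratingSet {G : Type*} [Group G] (S : Set G) : Prop :=
  Subgroup.closure S = ⊤ ∧ ∀ s ∈ S, Subgroup.closure (S \ {s}) ≠ ⊤

/-- `minGen G = d(G)` is the minimal size of a generating set of `G`. -/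
noncomputable def minGen (G : Type*) [Group G] : ℕ :=
  sInf {n | ∃ S : Finset G, S.card = n ∧ Subgroup.closure (S : Set G) = ⊤}

/-- The minimal generating set exchange property (MGSE): whenever
`G = ⟨x_1,…,x_d⟩ = ⟨y_1,…,y_d⟩` with `d = d(G)`, for every `i` there exists `j`
such that replacing `x_i` by `y_j` still yields a generating set. -/
def MGSE (G : Type*) [Group G] : Prop :=
  ∀ x y : Fin (minGen G) → G,
    Subgroup.closure (Set.range x) = ⊤ → Subgroup.closure (Set.range y) = ⊤ →
    ∀ i : Fin (minGen G), ∃ j : Fin (minGen G),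
      Subgroup.closure (Set.range (Function.update x i (y j))) = ⊤

/-- A nontrivial finite solvable group has a nontrivial normal `q`-subgroup for some prime `q`. -/
theorem exists_normal_isPGroup_of_isSolvable (H : Type*) [Group H] [Finite H] [Nontrivial H]
    [Group.IsSolvable H] :
    ∃ (q : ℕ) (N : Subgroup H), q.Prime ∧ N.Normal ∧ IsPGroup q N ∧ N ≠ ⊥ := by
  classical
  have hsol : ∃ n, derivedSeries H n = ⊥ := Group.IsSolvable.solvable
  obtain ⟨n, hn⟩ : ∃ n, Nat.find hsol = n + 1 := by
    refine Nat.exists_eq_succ_of_ne_zero fun h0 => ?_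
    have h := Nat.find_spec hsol
    rw [h0, derivedSeries_zero] at h
    exact top_ne_bot h
  have hbot : derivedSeries H (n + 1) = ⊥ := hn ▸ Nat.find_spec hsol
  have hne : derivedSeries H n ≠ ⊥ := Nat.find_min hsol (by omega)
  have hA : (derivedSeries H n).Normal := derivedSeries_normal H n
  rw [derivedSeries_succ, Subgroup.commutator_eq_bot_iff_le_centralizer] at hbot
  generalize derivedSeries H n = A at *
  have hcomm : ∀ a ∈ A, ∀ b ∈ A, a * b = b * a := fun a ha b hb =>
    (Subgroup.mem_centralizer_iff.1 (hbot hb)) a ha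
  obtain ⟨q, hq, hdvd⟩ := Nat.exists_prime_and_dvd (n := Nat.card A)
    (fun h => hne (Subgroup.card_eq_one.1 h))
  have : Fact q.Prime := ⟨hq⟩
  let N : Subgroup H :=
    { carrier := {a | a ∈ A ∧ a ^ q = 1}
      one_mem' := ⟨A.one_mem, one_pow q⟩
      mul_mem' := fun {a b} ha hb =>
        ⟨A.mul_mem ha.1 hb.1, by
          rw [(show Commute a b from hcomm a ha.1 b hb.1).mul_pow, ha.2, hb.2, one_mul]⟩
      inv_mem' := fun {a} ha => ⟨A.inv_mem ha.1, by rw [inv_pow, ha.2, inv_one]⟩ }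
  refine ⟨q, N, hq, ⟨fun a ha g => ⟨hA.conj_mem a ha.1 g, ?_⟩⟩, fun a => ⟨1, ?_⟩, fun hbotN => ?_⟩
  · rw [conj_pow, ha.2, mul_one, mul_inv_cancel]
  · rw [pow_one]
    exact Subtype.ext a.2.2
  · obtain ⟨a, ha⟩ := exists_prime_orderOf_dvd_card' q hdvd
    have haN : (a : H) ∈ N := ⟨a.2, by
      rw [← ha, ← Subgroup.orderOf_coe, pow_orderOf_eq_one]⟩
    rw [hbotN, Subgroup.mem_bot] at haN
    rw [show a = 1 from Subtype.ext haN, orderOf_one] at ha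
    exact hq.one_lt.ne ha

section Complement

variable {G : Type*} [Group G] {V H : Subgroup G}

/-- A normal subgroup with a complement `H` is the kernel of a retraction onto `H`. -/
theorem exists_retraction_of_isComplement' [V.Normal] (hcomp : V.IsComplement' H) :
    ∃ φ : G →* H, (∀ h : H, φ h = h) ∧ ∀ g, φ g = 1 ↔ g ∈ V := by
  refine ⟨hcomp.symm.QuotientMulEquiv.toMonoidHom.comp (QuotientGroup.mk' V), fun h => ?_,
    fun g => ?_⟩
  · exact hcomp.symm.QuotientMulEquiv.apply_symm_apply h
  · rw [← QuotientGroup.eq_one_iff (N := V) g]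
    exact hcomp.symm.QuotientMulEquiv.map_eq_one_iff

variable {φ : G →* H}

theorem eq_one_of_mem_of_mem (hφH : ∀ h : H, φ h = h) (hφV : ∀ g, φ g = 1 ↔ g ∈ V)
    {g : G} (hV : g ∈ V) (hH : g ∈ H) : g = 1 := by
  have h := hφH ⟨g, hH⟩
  rw [(hφV g).2 hV] at h
  exact congrArg Subtype.val h.symm

theorem mul_inv_retraction_mem (hφH : ∀ h : H, φ h = h) (hφV : ∀ g, φ g = 1 ↔ g ∈ V) (g : G) :
    g * (φ g : G)⁻¹ ∈ V := by
  rw [← hφV]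
  simp [hφH]

/-- In a minimal normal subgroup `V`, on which `H` acts faithfully, a nontrivial normal subgroup
of `H` has no nontrivial fixed points. -/
theorem eq_one_of_commute_normal [V.Normal]
    (hVab : ∀ a ∈ V, ∀ b ∈ V, a * b = b * a)
    (hVmin : ∀ W : Subgroup G, W ≤ V → W.Normal → W = ⊥ ∨ W = V)
    (hfaithful : ∀ h ∈ H, (∀ v ∈ V, h * v = v * h) → h = 1)
    (hφH : ∀ h : H, φ h = h) (hφV : ∀ g, φ g = 1 ↔ g ∈ V)
    (N : Subgroup H) [N.Normal] (hN : N ≠ ⊥) {v : G} (hv : v ∈ V)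
    (hvN : ∀ n ∈ N, (n : G) * v = v * n) : v = 1 := by
  let C : Subgroup G := V ⊓ Subgroup.centralizer (N.map H.subtype : Set G)
  have mem_C : ∀ g, g ∈ C ↔ g ∈ V ∧ ∀ n ∈ N, (n : G) * g = g * n := by
    intro g
    simp only [C, Subgroup.mem_inf, Subgroup.mem_centralizer_iff]
    refine and_congr_right fun _ => ⟨fun h n hn => h n ⟨n, hn, rfl⟩, ?_⟩
    rintro h _ ⟨n, hn, rfl⟩
    exact h n hn
  have hC : C.Normal := by
    refine ⟨fun c hc g => ?_⟩
    have hcV := ((mem_C c).1 hc).1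
    obtain ⟨w, hw, hg⟩ : ∃ w ∈ V, g = w * (φ g : G) :=
      ⟨_, mul_inv_retraction_mem hφH hφV g, by group⟩
    generalize φ g = h at hg
    subst hg
    have hconj : (h : G) * c * (h : G)⁻¹ ∈ V := ‹V.Normal›.conj_mem c hcV h
    have heq : w * h * c * (w * (h : G))⁻¹ = h * c * (h : G)⁻¹ := by
      calc w * h * c * (w * (h : G))⁻¹ = w * (h * c * (h : G)⁻¹) * w⁻¹ := by group
        _ = h * c * (h : G)⁻¹ := by rw [hVab w hw _ hconj]; group
    rw [heq, mem_C]
    refine ⟨hconj, fun n hn => ?_⟩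
    have hn' := ((mem_C c).1 hc).2 _ (‹N.Normal›.conj_mem n hn h⁻¹)
    push_cast at hn'
    calc (n : G) * (h * c * (h : G)⁻¹)
        = h * (((h : G)⁻¹ * n * (h : G)⁻¹⁻¹) * c) * (h : G)⁻¹ := by group
      _ = h * c * (h : G)⁻¹ * n := by rw [hn']; group
  rcases hVmin C inf_le_left hC with h | h
  · have : v ∈ C := (mem_C v).2 ⟨hv, hvN⟩
    rwa [h, Subgroup.mem_bot] at this
  · refine absurd ((Subgroup.eq_bot_iff_forall N).2 fun n hn => ?_) hN
    refine Subtype.ext (hfaithful n n.2 fun w hw => ?_)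
    exact ((mem_C w).1 (h ▸ hw)).2 n hn

/-- A `q`-subgroup of `H` without nontrivial fixed points on `V` forces `q ∤ |V|`. -/
theorem not_dvd_card_of_fixedPointFree [V.Normal] [Finite G] {q : ℕ} [Fact q.Prime]
    {N : Subgroup H} (hNq : IsPGroup q N)
    (hfix : ∀ v ∈ V, (∀ n ∈ N, (n : G) * v = v * n) → v = 1) : ¬ q ∣ Nat.card V := by
  intro hdvd
  let _ : MulAction N V :=
    MulAction.compHom V ((MulAut.conjNormal (H := V)).comp (H.subtype.comp N.subtype))
  have smul_coe : ∀ (n : N) (v : V), ((n • v : V) : G) = (n : H) * v * ((n : H) : G)⁻¹ :=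
    fun n v => MulAut.conjNormal_apply _ _
  have h1 : (1 : V) ∈ MulAction.fixedPoints N V := fun n => Subtype.ext (by simp [smul_coe])
  obtain ⟨b, hb, hne⟩ := hNq.exists_fixed_point_of_prime_dvd_card_of_fixed_point V hdvd h1
  refine hne (Subtype.ext (hfix b b.2 fun n hn => ?_).symm)
  have h := congrArg Subtype.val (hb ⟨n, hn⟩)
  rw [smul_coe] at h
  exact mul_inv_eq_iff_eq_mul.1 h

/-- If `H` has a normal `q`-subgroup acting without nontrivial fixed points on `V`, then every
complement of `V` is conjugate into `H`. -/
theorem exists_conj_mem_of_fixedPointFree [V.Normal] [Finite G]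
    (hcomp : V.IsComplement' H)
    (hφH : ∀ h : H, φ h = h) (hφV : ∀ g, φ g = 1 ↔ g ∈ V)
    {q : ℕ} [Fact q.Prime] {N : Subgroup H} [N.Normal] (hNq : IsPGroup q N)
    (hfix : ∀ v ∈ V, (∀ n ∈ N, (n : G) * v = v * n) → v = 1)
    {K : Subgroup G} (hKV : ∀ k ∈ K, k ∈ V → k = 1) (hKφ : ∀ h : H, ∃ k ∈ K, φ k = h) :
    ∃ v ∈ V, ∀ k ∈ K, v⁻¹ * k * v ∈ H := by
  have hq : ¬ q ∣ Nat.card (G ⧸ H) := by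
    have h := hcomp.index_eq_card
    rw [Subgroup.index] at h
    rw [h]
    exact not_dvd_card_of_fixedPointFree hNq hfix
  have hMq : IsPGroup q (K ⊓ N.comap φ : Subgroup G) := by
    rintro ⟨m, hmK, hmN⟩
    obtain ⟨k, hk⟩ := hNq ⟨φ m, hmN⟩
    refine ⟨k, Subtype.ext (hKV _ (K.pow_mem hmK _) ((hφV _).1 ?_))⟩
    exact (map_pow φ m _).trans (congrArg Subtype.val hk)
  obtain ⟨x, hx⟩ := hMq.nonempty_fixed_point_of_prime_not_dvd_card (G ⧸ H) hq
  obtain ⟨g, rfl⟩ := QuotientGroup.mk_surjective x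
  have hv := mul_inv_retraction_mem hφH hφV g
  have hvg : ∀ k, (g * (φ g : G)⁻¹)⁻¹ * k * (g * (φ g : G)⁻¹)
      = φ g * (g⁻¹ * k * g) * (φ g : G)⁻¹ := fun k => by group
  generalize hvdef : g * (φ g : G)⁻¹ = v at hv hvg
  have hφv := (hφV v).2 hv
  have hM : ∀ k ∈ K, φ k ∈ N → v⁻¹ * k * v = φ k := by
    intro k hk hkN
    have h := hx ⟨k, hk, hkN⟩
    have h' : ((k * g : G) : G ⧸ H) = (g : G ⧸ H) := h
    have hmem : v⁻¹ * k * v ∈ H := by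
      rw [hvg]
      refine H.mul_mem (H.mul_mem (φ g).2 ?_) (H.inv_mem (φ g).2)
      have := QuotientGroup.eq.1 h'.symm
      rwa [← mul_assoc] at this
    have := hφH ⟨_, hmem⟩
    simp only [map_mul, map_inv, hφv] at this
    simpa using (congrArg Subtype.val this).symm
  refine ⟨v, hv, fun k hk => ?_⟩
  suffices h : v⁻¹ * k * v * (φ k : G)⁻¹ = 1 by
    rw [mul_inv_eq_one.1 h]
    exact (φ k).2
  refine hfix _ ((hφV _).1 (by simp [hφv, hφH])) fun n hn => ?_
  obtain ⟨m, hmK, hm⟩ := hKφ ((φ k)⁻¹ * n * φ k)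
  have hmN : φ m ∈ N := by
    rw [hm]
    simpa using ‹N.Normal›.conj_mem n hn (φ k)⁻¹
  have h₁ := hM m hmK hmN
  have hφc : φ (k * m * k⁻¹) = n := by
    rw [map_mul, map_mul, map_inv, hm]
    group
  have h₂ := hM (k * m * k⁻¹) (K.mul_mem (K.mul_mem hk hmK) (K.inv_mem hk)) (hφc ▸ hn)
  rw [hφc] at h₂
  rw [hm] at h₁
  push_cast at h₁
  calc (n : G) * (v⁻¹ * k * v * (φ k : G)⁻¹)
      = v⁻¹ * k * v * (v⁻¹ * m * v) * (φ k : G)⁻¹ := by rw [← h₂]; group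
    _ = v⁻¹ * k * v * (φ k : G)⁻¹ * n := by rw [h₁]; group

/-- If complements of `V` are conjugate into `H`, then any generating tuple of `H` with a
nontrivial entry away from `i` lifts to a generating tuple of `G` differing only at `i`. -/
theorem exists_update_closure_eq_top [V.Normal] [Finite G] {ι : Type*} [DecidableEq ι]
    (hVab : ∀ a ∈ V, ∀ b ∈ V, a * b = b * a)
    (hVmin : ∀ W : Subgroup G, W ≤ V → W.Normal → W = ⊥ ∨ W = V)
    (hfaithful : ∀ h ∈ H, (∀ v ∈ V, h * v = v * h) → h = 1)
    (hφH : ∀ h : H, φ h = h) (hφV : ∀ g, φ g = 1 ↔ g ∈ V)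
    (hconj : ∀ K : Subgroup G, (∀ k ∈ K, k ∈ V → k = 1) → (∀ h : H, ∃ k ∈ K, φ k = h) →
      ∃ v ∈ V, ∀ k ∈ K, v⁻¹ * k * v ∈ H)
    {h : ι → H} (hgen : Subgroup.closure (Set.range h) = ⊤) {i j : ι} (hij : j ≠ i)
    (hj : h j ≠ 1) :
    ∃ w ∈ V, Subgroup.closure (Set.range (Function.update (fun k => (h k : G)) i (h i * w))) =
      ⊤ := by
  by_contra! hcon
  have key : ∀ w : V, ∃ v : V, (h j : G) * v = v * h j ∧ (h i : G) * w = v * h i * (v : G)⁻¹ := by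
    rintro ⟨w, hw⟩
    have hne := hcon w hw
    set x : ι → G := Function.update (fun k => (h k : G)) i (h i * w) with hxdef
    set K := Subgroup.closure (Set.range x) with hK
    have hxK : ∀ k, x k ∈ K := fun k => Subgroup.subset_closure ⟨k, rfl⟩
    have hφx : ∀ k, φ (x k) = h k := by
      intro k
      by_cases hk : k = i
      · subst hk
        simp [hxdef, hφH, (hφV w).2 hw]
      · simp [hxdef, hk, hφH]
    have hKφ : ∀ a : H, ∃ k ∈ K, φ k = a := by
      have hmap : K.map φ = ⊤ := by
        rw [hK, MonoidHom.map_closure, ← Set.range_comp, ← hgen]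
        congr 2
        exact funext hφx
      intro a
      exact (hmap ▸ Subgroup.mem_top a : a ∈ K.map φ)
    have hKVn : (K ⊓ V).Normal := by
      refine ⟨fun c hc g => ?_⟩
      obtain ⟨k, hk, hkg⟩ := hKφ (φ g)
      have hgk : g * k⁻¹ ∈ V := (hφV _).1 (by simp [hkg])
      have hkc : k * c * k⁻¹ ∈ K ⊓ V :=
        ⟨K.mul_mem (K.mul_mem hk hc.1) (K.inv_mem hk), ‹V.Normal›.conj_mem c hc.2 k⟩
      have : g * c * g⁻¹ = k * c * k⁻¹ := by
        calc g * c * g⁻¹ = g * k⁻¹ * (k * c * k⁻¹) * (g * k⁻¹)⁻¹ := by group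
          _ = k * c * k⁻¹ := by rw [hVab _ hgk _ hkc.2]; group
      rwa [this]
    rcases hVmin _ inf_le_right hKVn with hbot | htop
    · obtain ⟨v, hv, hvK⟩ := hconj K
        (fun k hk hkV => (Subgroup.mem_bot).1 (hbot ▸ ⟨hk, hkV⟩ : k ∈ (⊥ : Subgroup G))) hKφ
      have hfix : ∀ k, x k = v * h k * v⁻¹ := by
        intro k
        have h' := hφH ⟨_, hvK _ (hxK k)⟩
        simp only [map_mul, map_inv, (hφV v).2 hv, hφx] at h'
        have h'' := congrArg Subtype.val h'
        simp only [inv_one, one_mul, mul_one] at h''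
        rw [h'']
        group
      refine ⟨⟨v, hv⟩, ?_, ?_⟩
      · have := hfix j
        rw [hxdef, Function.update_of_ne hij] at this
        exact mul_inv_eq_iff_eq_mul.1 this.symm |>.symm
      · simpa [hxdef] using hfix i
    · refine absurd ((Subgroup.eq_top_iff' K).2 fun g => ?_) hne
      obtain ⟨k, hk, hkg⟩ := hKφ (φ g)
      have hgk : g * k⁻¹ ∈ V := (hφV _).1 (by simp [hkg])
      rw [← htop] at hgk
      simpa using K.mul_mem hgk.1 hk
  choose f hf₁ hf₂ using key
  have hinj : Function.Injective f := by
    intro a b hab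
    have h' := hf₂ a
    rw [hab, ← hf₂ b] at h'
    exact Subtype.ext (mul_left_cancel h')
  refine hj (Subtype.ext (hfaithful _ (h j).2 fun v hv => ?_))
  obtain ⟨w, hw⟩ := Finite.surjective_of_injective hinj ⟨v, hv⟩
  simpa [hw] using hf₁ w

end Complement

section MinGen

theorem minGen_le_card {G : Type*} [Group G] {S : Finset G}
    (hS : Subgroup.closure (S : Set G) = ⊤) : minGen G ≤ S.card :=
  Nat.sInf_le ⟨S, rfl, hS⟩

theorem minGen_le_of_closure_range {G : Type*} [Group G] {n : ℕ} {x : Fin n → G}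
    (hx : Subgroup.closure (Set.range x) = ⊤) : minGen G ≤ n := by
  classical
  refine (minGen_le_card (S := Finset.univ.image x) (by simpa using hx)).trans ?_
  simpa using Finset.card_image_le (s := Finset.univ) (f := x)

theorem exists_closure_range_eq_top (G : Type*) [Group G] [Finite G] :
    ∃ x : Fin (minGen G) → G, Subgroup.closure (Set.range x) = ⊤ := by
  have hne : {n | ∃ S : Finset G, S.card = n ∧ Subgroup.closure (S : Set G) = ⊤}.Nonempty := by
    have := Fintype.ofFinite G
    exact ⟨_, Finset.univ, rfl, by simp⟩
  obtain ⟨S, hcard, hS⟩ := Nat.sInf_mem hne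
  change S.card = minGen G at hcard
  refine ⟨fun k => (S.equivFinOfCardEq hcard).symm k, Eq.trans ?_ hS⟩
  congr 1
  ext g
  constructor
  · rintro ⟨k, rfl⟩
    exact ((S.equivFinOfCardEq hcard).symm k).2
  · intro hg
    exact ⟨S.equivFinOfCardEq hcard ⟨g, hg⟩, by simp⟩

/-- A tuple of length `d(G)` does not generate `G` after omitting an entry. -/
theorem closure_ne_top_of_subset_image_compl {G : Type*} [Group G] (x : Fin (minGen G) → G)
    (i : Fin (minGen G)) {T : Set G} (hT : T ⊆ x '' {i}ᶜ) : Subgroup.closure T ≠ ⊤ := by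
  classical
  intro h
  have hle := minGen_le_card (G := G) (S := (Finset.univ.erase i).image x) <| by
    rw [eq_top_iff, ← h]
    refine Subgroup.closure_mono (hT.trans ?_)
    rintro _ ⟨k, hk, rfl⟩
    exact Finset.mem_coe.2 (Finset.mem_image_of_mem x (by simpa using hk))
  have hcard := (Finset.card_image_le (s := Finset.univ.erase i) (f := x))
  rw [Finset.card_erase_of_mem (Finset.mem_univ i), Finset.card_univ, Fintype.card_fin] at hcard
  have := i.pos
  omega

theorem one_lt_minGen_of_not_isCyclic {G : Type*} [Group G] [Finite G] (hG : ¬ IsCyclic G) :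
    1 < minGen G := by
  by_contra! hle
  obtain ⟨x, hx⟩ := exists_closure_range_eq_top G
  have hsub : Subsingleton (Fin (minGen G)) := Fin.subsingleton_iff_le_one.2 hle
  refine hG ?_
  rcases isEmpty_or_nonempty (Fin (minGen G)) with hE | ⟨⟨k⟩⟩
  · rw [Set.range_eq_empty, Subgroup.closure_empty] at hx
    have := Subgroup.subsingleton_iff.1 (subsingleton_of_bot_eq_top hx)
    infer_instance
  · refine isCyclic_iff_exists_zpowers_eq_top.2 ⟨x k, ?_⟩
    rw [Subgroup.zpowers_eq_closure, ← hx]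
    congr 1
    ext g
    constructor
    · rintro rfl
      exact ⟨k, rfl⟩
    · rintro ⟨l, rfl⟩
      rw [Subsingleton.elim l k]
      rfl

theorem minGen_le_of_surjective {G H : Type*} [Group G] [Group H] [Finite G] {f : G →* H}
    (hf : Function.Surjective f) : minGen H ≤ minGen G := by
  obtain ⟨x, hx⟩ := exists_closure_range_eq_top G
  refine minGen_le_of_closure_range (x := f ∘ x) ?_
  rw [Set.range_comp, ← MonoidHom.map_closure, hx, Subgroup.map_top_of_surjective f hf]

theorem MGSE.exchange {G : Type*} [Group G] (hG : MGSE G) {n : ℕ} (hn : minGen G = n)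
    {x y : Fin n → G} (hx : Subgroup.closure (Set.range x) = ⊤)
    (hy : Subgroup.closure (Set.range y) = ⊤) (i : Fin n) :
    ∃ j, Subgroup.closure (Set.range (Function.update x i (y j))) = ⊤ := by
  subst hn
  exact hG x y hx hy i

end MinGen

/-- Let `G = V ⋊ H` where `V` is an abelian minimal normal subgroup of `G`
(a faithful irreducible `H`-module, i.e. `C_H(V) = 1`). If `H` is solvable and
non-cyclic, then `G` does not satisfy the MGSE property. -/
theorem not_mgse_of_noncyclic_complement {G : Type*} [Group G] [Finite G]
    (V H : Subgroup G)
    (hVnormal : V.Normal)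
    (hVab : ∀ a ∈ V, ∀ b ∈ V, a * b = b * a)
    (hVne : V ≠ ⊥)
    (hVmin : ∀ W : Subgroup G, W ≤ V → W.Normal → W = ⊥ ∨ W = V)
    (hcomp : V.IsComplement' H)
    (hfaithful : ∀ h ∈ H, (∀ v ∈ V, h * v = v * h) → h = 1)
    (hHsolv : IsSolvable H) (hHnc : ¬ IsCyclic H) :
    ¬ MGSE G := by
  intro hG
  obtain ⟨φ, hφH, hφV⟩ := exists_retraction_of_isComplement' hcomp
  have hnt : Nontrivial H := by
    by_contra hcon
    have := not_nontrivial_iff_subsingleton.1 hcon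
    exact hHnc inferInstance
  have : Group.IsSolvable H := hHsolv
  obtain ⟨q, N, hq, hNn, hNq, hNne⟩ := exists_normal_isPGroup_of_isSolvable H
  have : Fact q.Prime := ⟨hq⟩
  have hfix : ∀ v ∈ V, (∀ n ∈ N, (n : G) * v = v * n) → v = 1 := fun v hv =>
    eq_one_of_commute_normal hVab hVmin hfaithful hφH hφV N hNne hv
  obtain ⟨h, hgen⟩ := exists_closure_range_eq_top H
  have hlt := one_lt_minGen_of_not_isCyclic hHnc
  have hne_one : ∀ k, h k ≠ 1 := by
    intro k hk
    refine closure_ne_top_of_subset_image_compl h k (T := Set.range h \ {1}) ?_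
      (by rwa [Subgroup.closure_sdiff_one])
    rintro _ ⟨⟨l, rfl⟩, hl⟩
    exact ⟨l, fun hlk => hl (by rw [hlk]; exact hk), rfl⟩
  have lift : ∀ i j, j ≠ i → ∃ w ∈ V, Subgroup.closure
      (Set.range (Function.update (fun k => (h k : G)) i (h i * w))) = ⊤ := fun i j hij =>
    exists_update_closure_eq_top hVab hVmin hfaithful hφH hφV
      (fun K hKV hKφ => exists_conj_mem_of_fixedPointFree hcomp hφH hφV hNq hfix hKV hKφ)
      hgen hij (hne_one j)
  obtain ⟨i₀, i₁, hi⟩ : ∃ i j : Fin (minGen H), j ≠ i :=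
    ⟨⟨0, by omega⟩, ⟨1, hlt⟩, by simp⟩
  obtain ⟨w, hw, hx⟩ := lift i₀ i₁ hi
  obtain ⟨u, hu, hy⟩ := lift i₁ i₀ hi.symm
  have hd : minGen G = minGen H :=
    (minGen_le_of_closure_range hx).antisymm (minGen_le_of_surjective fun a => ⟨a, hφH a⟩)
  obtain ⟨j, hj⟩ := hG.exchange hd hx hy i₀
  rw [Function.update_idem] at hj
  by_cases hji : j = i₁
  · subst hji
    rw [Function.update_self] at hj
    have hmap := congrArg (Subgroup.map φ) hj
    rw [MonoidHom.map_closure, Subgroup.map_top_of_surjective φ fun a => ⟨a, hφH a⟩] at hmap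
    refine closure_ne_top_of_subset_image_compl h i₀ ?_ hmap
    rintro _ ⟨_, ⟨k, rfl⟩, rfl⟩
    by_cases hk : k = i₀
    · subst hk
      exact ⟨j, hi, by simp [hφH, (hφV u).2 hu]⟩
    · exact ⟨k, hk, by simp [hk, hφH]⟩
  · rw [Function.update_of_ne hji] at hj
    have hHtop : ∀ g : G, g ∈ H := by
      have : (⊤ : Subgroup G) ≤ H := by
        rw [← hj, Subgroup.closure_le]
        rintro _ ⟨k, rfl⟩
        by_cases hk : k = i₀
        · subst hk
          simp
        · simp [hk]
      exact fun g => this trivial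
    exact hVne ((Subgroup.eq_bot_iff_forall V).2 fun v hv =>
      eq_one_of_mem_of_mem hφH hφV hv (hHtop v))
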